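/- Let 1 ≤ p < ∞, let f ∈ U_p(ℝ²), and for h > 0 set f_h(x,y) = h^{−2} ∫₀^h ∫₀^h f(x+u, y+v) du dv. Then for all (x,y) ∈ ℝ² and all u, v with 0 ≤ u, v ≤ h, |f_h(x+u, y+v) − f_h(x,y)| ≤ h^{1/p} [φ₁**(h) + φ₂**(h)], where φ₁(y) = ‖f_y‖*_{Lip 1/p}, φ₂(x) = ‖f_x‖*_{Lip 1/p}, and φ**(t) = (1/t)∫₀^t φ*(u) du. -/

import Mathlib

open MeasureTheory Set
open scoped ENNReal

noncomputable section

/-- Extended essential sup norm on ℝ. -/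
def einf (φ : ℝ → ℝ) : ℝ≥0∞ := eLpNorm φ ⊤ volume

/-- Lipschitz `α` seminorm (extended real valued):
`sup_{h>0} h^{-α} ‖φ(·+h) - φ‖_∞`. -/
def lipSemiE (α : ℝ) (φ : ℝ → ℝ) : ℝ≥0∞ :=
  ⨆ h ∈ Ioi (0:ℝ), ENNReal.ofReal (h ^ (-α)) * einf (fun x => φ (x + h) - φ x)

/-- Real-valued Lipschitz `α` seminorm `‖φ‖*_{Lip α}`. -/
def lipSemi (α : ℝ) (φ : ℝ → ℝ) : ℝ := (lipSemiE α φ).toReal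

/-- `φ ∈ Lip α`: essentially bounded with finite Lipschitz `α` seminorm. -/
def MemLip (α : ℝ) (φ : ℝ → ℝ) : Prop := einf φ < ⊤ ∧ lipSemiE α φ < ⊤

/-- `‖φ‖_{Lip α} = ‖φ‖_∞ + ‖φ‖*_{Lip α}`. -/
def lipNorm (α : ℝ) (φ : ℝ → ℝ) : ℝ := (einf φ + lipSemiE α φ).toReal

/-- The class `S₀`: measurable functions with finite distribution function at every
positive level. -/
def S0 {X : Type*} [MeasureSpace X] (f : X → ℝ) : Prop :=
  Measurable f ∧ ∀ s : ℝ, 0 < s → volume {x | s < |f x|} < ⊤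

/-- The non-increasing rearrangement `f*`. -/
def rearr {X : Type*} [MeasureSpace X] (f : X → ℝ) (t : ℝ) : ℝ :=
  sInf {s : ℝ | 0 ≤ s ∧ volume {x | s < |f x|} ≤ ENNReal.ofReal t}

/-- `f**(t) = (1/t) ∫₀^t f*(u) du`. -/
def doubleStar {X : Type*} [MeasureSpace X] (f : X → ℝ) (t : ℝ) : ℝ :=
  (∫ u in Ioc (0:ℝ) t, rearr f u) / t

/-- Lorentz `L^{p,q}` norm. -/
def lorentzNorm {X : Type*} [MeasureSpace X] (p q : ℝ) (f : X → ℝ) : ℝ :=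
  (∫ t in Ioi (0:ℝ), (t ^ (1/p) * rearr f t) ^ q / t) ^ (1/q)

/-- Membership in the Lorentz space `L^{p,q}`. -/
def MemLorentz {X : Type*} [MeasureSpace X] (p q : ℝ) (f : X → ℝ) : Prop :=
  S0 f ∧ IntegrableOn (fun t => (t ^ (1/p) * rearr f t) ^ q / t) (Ioi (0:ℝ))

/-- The space `U_p(ℝ²)`: a.e. sections in `Lip (1/p)`, with `Lip (1/p)` norms of the
sections in `L^{p,1}(ℝ)`. -/
def MemUp (p : ℝ) (f : ℝ × ℝ → ℝ) : Prop :=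
  Measurable f ∧
  (∀ᵐ y : ℝ ∂volume, MemLip (1/p) (fun x => f (x, y))) ∧
  (∀ᵐ x : ℝ ∂volume, MemLip (1/p) (fun y => f (x, y))) ∧
  MemLorentz p 1 (fun y => lipNorm (1/p) (fun x => f (x, y))) ∧
  MemLorentz p 1 (fun x => lipNorm (1/p) (fun y => f (x, y)))

/-- The Steklov-type average `f_h`. -/
def avg (f : ℝ × ℝ → ℝ) (h : ℝ) (z : ℝ × ℝ) : ℝ :=
  (∫ u in Ioc (0:ℝ) h, ∫ v in Ioc (0:ℝ) h, f (z.1 + u, z.2 + v)) / h ^ 2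

lemma rearr_nonneg (φ : ℝ → ℝ) (t : ℝ) : 0 ≤ rearr φ t :=
  Real.sInf_nonneg fun _ hs => hs.1

lemma bddBelow_rearr_set (φ : ℝ → ℝ) (t : ℝ) :
    BddBelow {s : ℝ | 0 ≤ s ∧ volume {x | s < |φ x|} ≤ ENNReal.ofReal t} :=
  ⟨0, fun _ hs => hs.1⟩

/-- The rearrangement is translation invariant. -/
lemma rearr_comp_add_left (φ : ℝ → ℝ) (y t : ℝ) :
    rearr (fun x => φ (y + x)) t = rearr φ t := by
  have key : ∀ s : ℝ, volume {x | s < |φ (y + x)|} = volume {x | s < |φ x|} := fun s =>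
    measure_preimage_add volume y {x | s < |φ x|}
  simp only [rearr, key]

/-- For a function in `S₀` the set defining the rearrangement at `t > 0` is nonempty. -/
lemma S0.exists_volume_le {N : ℝ → ℝ} (hN : S0 N) {t : ℝ} (ht : 0 < t) :
    {s : ℝ | 0 ≤ s ∧ volume {x | s < |N x|} ≤ ENNReal.ofReal t}.Nonempty := by
  have hlim : Filter.Tendsto (fun n : ℕ => volume {x | ((n : ℝ) + 1) < |N x|}) Filter.atTop
      (nhds (volume (⋂ n : ℕ, {x | ((n : ℝ) + 1) < |N x|}))) := by
    refine tendsto_measure_iInter_atTop (fun n => ?_) ?_ ⟨0, ?_⟩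
    · exact (measurableSet_lt measurable_const hN.1.abs).nullMeasurableSet
    · intro m n hmn x hx
      have : (m : ℝ) ≤ n := by exact_mod_cast hmn
      simp only [mem_ofPred_eq] at hx ⊢
      linarith
    · exact (hN.2 _ (by positivity)).ne
  have hempty : (⋂ n : ℕ, {x | ((n : ℝ) + 1) < |N x|}) = ∅ := by
    ext x
    obtain ⟨n, hn⟩ := exists_nat_gt |N x|
    simp only [mem_iInter, mem_ofPred_eq, mem_empty_iff_false, iff_false, not_forall, not_lt]
    exact ⟨n, by linarith⟩
  rw [hempty, measure_empty] at hlim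
  obtain ⟨n, hn⟩ :=
    (hlim.eventually (gt_mem_nhds (ENNReal.ofReal_pos.2 ht))).exists
  exact ⟨n + 1, by positivity, hn.le⟩

lemma volume_lt_abs_mono {φ N : ℝ → ℝ} (hφN : ∀ᵐ x, |φ x| ≤ |N x|) (s : ℝ) :
    volume {x | s < |φ x|} ≤ volume {x | s < |N x|} :=
  measure_mono_ae (hφN.mono fun _ hx (h : s < _) => h.trans_le hx)

lemma rearr_set_nonempty {φ N : ℝ → ℝ} (hN : S0 N) (hφN : ∀ᵐ x, |φ x| ≤ |N x|)
    {t : ℝ} (ht : 0 < t) :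
    {s : ℝ | 0 ≤ s ∧ volume {x | s < |φ x|} ≤ ENNReal.ofReal t}.Nonempty := by
  obtain ⟨s, hs, hs'⟩ := hN.exists_volume_le ht
  exact ⟨s, hs, (volume_lt_abs_mono hφN s).trans hs'⟩

lemma rearr_mono {φ N : ℝ → ℝ} (hN : S0 N) (hφN : ∀ᵐ x, |φ x| ≤ |N x|)
    {t : ℝ} (ht : 0 < t) : rearr φ t ≤ rearr N t :=
  csInf_le_csInf (bddBelow_rearr_set φ t) (hN.exists_volume_le ht)
    fun s hs => ⟨hs.1, (volume_lt_abs_mono hφN s).trans hs.2⟩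

lemma rearr_antitoneOn {φ N : ℝ → ℝ} (hN : S0 N) (hφN : ∀ᵐ x, |φ x| ≤ |N x|) :
    AntitoneOn (rearr φ) (Ioi 0) := fun _ ht _ _ htt =>
  csInf_le_csInf (bddBelow_rearr_set φ _) (rearr_set_nonempty hN hφN ht)
    fun _ hs => ⟨hs.1, hs.2.trans (ENNReal.ofReal_le_ofReal htt)⟩

lemma aemeasurable_rearr {φ N : ℝ → ℝ} (hN : S0 N) (hφN : ∀ᵐ x, |φ x| ≤ |N x|) (a : ℝ) :
    AEMeasurable (rearr φ) (volume.restrict (Ioc 0 a)) :=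
  aemeasurable_restrict_of_antitoneOn measurableSet_Ioc
    ((rearr_antitoneOn hN hφN).mono fun _ hx => hx.1)

/-- A function dominated by an element of `L^{p,1}` has locally integrable rearrangement. -/
lemma integrableOn_rearr {p : ℝ} (hp : 1 ≤ p) {φ N : ℝ → ℝ} (hN : MemLorentz p 1 N)
    (hφN : ∀ᵐ x, |φ x| ≤ |N x|) (a : ℝ) :
    IntegrableOn (rearr φ) (Ioc 0 a) := by
  have hint : IntegrableOn (fun t => a ^ (1 - 1 / p) * ((t ^ (1 / p) * rearr N t) ^ (1 : ℝ) / t))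
      (Ioc 0 a) := (hN.2.mono_set fun _ hx => hx.1).const_mul _
  refine Integrable.mono' hint (aemeasurable_rearr hN.1 hφN a).aestronglyMeasurable ?_
  refine (ae_restrict_iff' measurableSet_Ioc).2 (Filter.Eventually.of_forall fun t ht => ?_)
  have ht0 : 0 < t := ht.1
  have hα : 0 ≤ 1 - 1 / p := by
    have : 1 / p ≤ 1 := by rw [div_le_one (by linarith)]; exact hp
    linarith
  rw [Real.norm_of_nonneg (rearr_nonneg _ _), Real.rpow_one]
  have h1 : t ^ (1 - 1 / p) ≤ a ^ (1 - 1 / p) := Real.rpow_le_rpow ht0.le ht.2 hα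
  have h2 : t ^ (1 - 1 / p) * t ^ (1 / p) = t := by
    rw [← Real.rpow_add ht0]; simp
  calc rearr φ t ≤ rearr N t := rearr_mono hN.1 hφN ht0
    _ = t ^ (1 - 1 / p) * (t ^ (1 / p) * rearr N t / t) := by
        rw [mul_div_assoc, ← mul_assoc, h2]; field_simp
    _ ≤ a ^ (1 - 1 / p) * (t ^ (1 / p) * rearr N t / t) := by
        have := rearr_nonneg N t
        gcongr

/-- The integral of a function over an interval of length `a` is at most the integral of the
rearrangement of any majorant over `(0, a]`. -/
lemma setLIntegral_le_rearr {g : ℝ → ℝ≥0∞} (hg : Measurable g) {φ N : ℝ → ℝ} (hN : S0 N)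
    (hφN : ∀ᵐ x, |φ x| ≤ |N x|) (hgφ : ∀ᵐ x, g x ≤ ENNReal.ofReal |φ x|) (a : ℝ) :
    ∫⁻ x in Ioc 0 a, g x ≤ ∫⁻ t in Ioc 0 a, ENNReal.ofReal (rearr φ t) := by
  have hfin : ∀ᵐ x ∂volume.restrict (Ioc 0 a), g x = ENNReal.ofReal (g x).toReal :=
    ae_restrict_of_ae (hgφ.mono fun x hx =>
      (ENNReal.ofReal_toReal (hx.trans_lt ENNReal.ofReal_lt_top).ne).symm)
  rw [lintegral_congr_ae hfin,
    lintegral_eq_lintegral_meas_lt _ (Filter.Eventually.of_forall fun _ => ENNReal.toReal_nonneg)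
      hg.ennreal_toReal.aemeasurable,
    lintegral_eq_lintegral_meas_le _ (Filter.Eventually.of_forall fun _ => rearr_nonneg _ _)
      (aemeasurable_rearr hN hφN a)]
  refine setLIntegral_mono_ae' measurableSet_Ioi (Filter.Eventually.of_forall fun s hs => ?_)
  set m := volume.restrict (Ioc 0 a) {x | s < (g x).toReal} with hm
  have hma : m ≤ ENNReal.ofReal a := by
    refine (measure_mono (subset_univ _)).trans ?_
    simp
  have hmfin : m ≠ ⊤ := (hma.trans_lt ENNReal.ofReal_lt_top).ne
  have hmφ : m ≤ volume {x | s < |φ x|} := by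
    refine (Measure.restrict_apply_le _ _).trans (measure_mono_ae (hgφ.mono fun x hx hsx => ?_))
    have : (g x).toReal ≤ |φ x| := ENNReal.toReal_le_of_le_ofReal (abs_nonneg _) hx
    exact lt_of_lt_of_le (show s < (g x).toReal from hsx) this
  have hsub : Ioo 0 m.toReal ⊆ {t | s ≤ rearr φ t} ∩ Ioc 0 a := by
    intro t ht
    have hta : t ≤ a := by
      have ha : 0 ≤ a := by
        by_contra hneg
        rw [ENNReal.ofReal_of_nonpos (not_le.1 hneg).le, nonpos_iff_eq_zero] at hma
        rw [hma] at ht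
        simp at ht
      exact ht.2.le.trans (ENNReal.toReal_le_of_le_ofReal ha hma)
    refine ⟨le_csInf (rearr_set_nonempty hN hφN ht.1) fun r hr => ?_, ht.1, hta⟩
    by_contra hrs
    have h1 : volume {x | s < |φ x|} ≤ volume {x | r < |φ x|} :=
      measure_mono fun x (hx : s < _) => (not_le.1 hrs).trans hx
    have h2 : m ≤ ENNReal.ofReal t := hmφ.trans (h1.trans hr.2)
    exact absurd (ENNReal.toReal_le_of_le_ofReal ht.1.le h2) (not_le.2 ht.2)
  calc m = volume (Ioo 0 m.toReal) := by simp [hmfin]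
    _ ≤ volume ({t | s ≤ rearr φ t} ∩ Ioc 0 a) := measure_mono hsub
    _ ≤ _ := Measure.le_restrict_apply _ _

/-- Translated and scaled form of `setLIntegral_le_rearr`, for majorants in `L^{p,1}`. -/
lemma setLIntegral_comp_add_left_le {p : ℝ} (hp : 1 ≤ p) {g : ℝ → ℝ≥0∞} (hg : Measurable g)
    {φ N : ℝ → ℝ} (hN : MemLorentz p 1 N) (hφN : ∀ᵐ x, |φ x| ≤ |N x|) {c : ℝ} (hc : 0 < c)
    (hgφ : ∀ᵐ x, g x ≤ ENNReal.ofReal (c * |φ x|)) (a y : ℝ) :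
    ∫⁻ x in Ioc 0 a, g (y + x) ≤ ENNReal.ofReal (c * ∫ t in Ioc 0 a, rearr φ t) := by
  have hq := (measurePreserving_add_left volume y).quasiMeasurePreserving
  have hNy : S0 (fun x => N (y + x)) := by
    refine ⟨hN.1.1.comp (measurable_const_add y), fun s hs => ?_⟩
    exact (measure_preimage_add volume y {x | s < |N x|}).trans_lt (hN.1.2 s hs)
  have hc' : ENNReal.ofReal c * ENNReal.ofReal c⁻¹ = 1 := by
    rw [← ENNReal.ofReal_mul hc.le, mul_inv_cancel₀ hc.ne', ENNReal.ofReal_one]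
  have hscaled : ∀ᵐ x, ENNReal.ofReal c⁻¹ * g (y + x) ≤ ENNReal.ofReal |φ (y + x)| := by
    filter_upwards [hq.ae hgφ] with x hx
    calc ENNReal.ofReal c⁻¹ * g (y + x)
        ≤ ENNReal.ofReal c⁻¹ * ENNReal.ofReal (c * |φ (y + x)|) := by gcongr
      _ = ENNReal.ofReal |φ (y + x)| := by
        rw [ENNReal.ofReal_mul hc.le, ← mul_assoc, mul_comm (ENNReal.ofReal c⁻¹), hc', one_mul]
  have key := setLIntegral_le_rearr ((hg.comp (measurable_const_add y)).const_mul
    (ENNReal.ofReal c⁻¹)) hNy (hq.ae hφN) hscaled a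
  simp only [rearr_comp_add_left] at key
  rw [← ofReal_integral_eq_lintegral_ofReal (integrableOn_rearr hp hN hφN a)
    (Filter.Eventually.of_forall fun _ => rearr_nonneg _ _)] at key
  calc ∫⁻ x in Ioc 0 a, g (y + x)
      = ENNReal.ofReal c * ∫⁻ x in Ioc 0 a, ENNReal.ofReal c⁻¹ * g (y + x) := by
        rw [lintegral_const_mul _ (by fun_prop), ← mul_assoc, hc', one_mul]
    _ ≤ ENNReal.ofReal c * ENNReal.ofReal (∫ t in Ioc 0 a, rearr φ t) := by gcongr; exact key
    _ = _ := (ENNReal.ofReal_mul hc.le).symm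

lemma setLIntegral_enorm_le_einf (φ : ℝ → ℝ) (x h : ℝ) :
    ∫⁻ s in Ioc 0 h, ‖φ (x + s)‖ₑ ≤ ENNReal.ofReal h * einf φ := by
  have hq := (measurePreserving_add_left volume x).quasiMeasurePreserving
  have hae : ∀ᵐ s, ‖φ s‖ₑ ≤ einf φ := by
    rw [einf, eLpNorm_exponent_top]
    exact ae_le_eLpNormEssSup
  calc ∫⁻ s in Ioc 0 h, ‖φ (x + s)‖ₑ ≤ ∫⁻ _ in Ioc 0 h, einf φ :=
        lintegral_mono_ae (ae_restrict_of_ae (hq.ae hae))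
    _ = _ := by simp [mul_comm]

lemma einf_sub_le_lipSemiE (α : ℝ) (φ : ℝ → ℝ) {u : ℝ} (hu : 0 ≤ u) :
    einf (fun x => φ (x + u) - φ x) ≤ ENNReal.ofReal (u ^ α) * lipSemiE α φ := by
  rcases hu.eq_or_lt with rfl | hu
  · have h0 : einf (fun x => φ (x + 0) - φ x) = 0 := by
      simp only [add_zero, sub_self, einf]
      exact eLpNorm_zero'
    rw [h0]
    exact zero_le
  · have hle : ENNReal.ofReal (u ^ (-α)) * einf (fun x => φ (x + u) - φ x) ≤ lipSemiE α φ :=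
      le_iSup₂_of_le (f := fun (h : ℝ) (_ : h ∈ Ioi (0 : ℝ)) =>
        ENNReal.ofReal (h ^ (-α)) * einf (fun x => φ (x + h) - φ x)) u hu le_rfl
    have h1 : ENNReal.ofReal (u ^ α) * ENNReal.ofReal (u ^ (-α)) = 1 := by
      rw [← ENNReal.ofReal_mul (by positivity), ← Real.rpow_add hu]; simp
    calc einf (fun x => φ (x + u) - φ x)
        = ENNReal.ofReal (u ^ α) *
            (ENNReal.ofReal (u ^ (-α)) * einf (fun x => φ (x + u) - φ x)) := by
          rw [← mul_assoc, h1, one_mul]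
      _ ≤ _ := by gcongr

lemma lipSemi_nonneg (α : ℝ) (φ : ℝ → ℝ) : 0 ≤ lipSemi α φ := ENNReal.toReal_nonneg

lemma lipNorm_nonneg (α : ℝ) (φ : ℝ → ℝ) : 0 ≤ lipNorm α φ := ENNReal.toReal_nonneg

lemma ofReal_lipSemi {α : ℝ} {φ : ℝ → ℝ} (hφ : MemLip α φ) :
    ENNReal.ofReal (lipSemi α φ) = lipSemiE α φ := ENNReal.ofReal_toReal hφ.2.ne

lemma ofReal_lipNorm {α : ℝ} {φ : ℝ → ℝ} (hφ : MemLip α φ) :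
    ENNReal.ofReal (lipNorm α φ) = einf φ + lipSemiE α φ :=
  ENNReal.ofReal_toReal (ENNReal.add_lt_top.2 hφ).ne

lemma abs_lipSemi_le {α : ℝ} {φ : ℝ → ℝ} (hφ : MemLip α φ) :
    |lipSemi α φ| ≤ |lipNorm α φ| := by
  rw [abs_of_nonneg (lipSemi_nonneg α φ), abs_of_nonneg (lipNorm_nonneg α φ)]
  exact ENNReal.toReal_mono (ENNReal.add_lt_top.2 hφ).ne le_add_self

section Sections

variable {p : ℝ} {F : ℝ × ℝ → ℝ}

lemma lintegral_lintegral_enorm_lt_top (hp : 1 ≤ p) (hF : Measurable F)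
    (hlip : ∀ᵐ y : ℝ, MemLip (1/p) (fun x => F (x, y)))
    (hN : MemLorentz p 1 (fun y => lipNorm (1/p) (fun x => F (x, y))))
    {h : ℝ} (hh : 0 < h) (x y : ℝ) :
    ∫⁻ t in Ioc 0 h, ∫⁻ s in Ioc 0 h, ‖F (x + s, y + t)‖ₑ < ⊤ := by
  have hmeas : Measurable fun t => ∫⁻ s in Ioc 0 h, ‖F (x + s, t)‖ₑ :=
    Measurable.lintegral_prod_right' (f := fun z : ℝ × ℝ => ‖F (x + z.2, z.1)‖ₑ) (by fun_prop)
  refine (setLIntegral_comp_add_left_le hp hmeas hN (Filter.Eventually.of_forall fun _ => le_rfl)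
    hh ?_ h y).trans_lt ENNReal.ofReal_lt_top
  filter_upwards [hlip] with t ht
  rw [abs_of_nonneg (lipNorm_nonneg _ _), ENNReal.ofReal_mul hh.le, ofReal_lipNorm ht]
  refine (setLIntegral_enorm_le_einf (fun s => F (s, t)) x h).trans ?_
  gcongr
  exact le_self_add

lemma lintegral_lintegral_enorm_sub_le (hp : 1 ≤ p) (hF : Measurable F)
    (hlip : ∀ᵐ y : ℝ, MemLip (1/p) (fun x => F (x, y)))
    (hN : MemLorentz p 1 (fun y => lipNorm (1/p) (fun x => F (x, y))))
    {h : ℝ} (hh : 0 < h) (x y : ℝ) {u : ℝ} (hu : 0 ≤ u) (huh : u ≤ h) :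
    ∫⁻ t in Ioc 0 h, ∫⁻ s in Ioc 0 h, ‖F (x + u + s, y + t) - F (x + s, y + t)‖ₑ ≤
      ENNReal.ofReal (h * h ^ (1/p) *
        ∫ t in Ioc 0 h, rearr (fun y' => lipSemi (1/p) (fun x' => F (x', y'))) t) := by
  have hmeas : Measurable fun t => ∫⁻ s in Ioc 0 h, ‖F (x + u + s, t) - F (x + s, t)‖ₑ :=
    Measurable.lintegral_prod_right'
      (f := fun z : ℝ × ℝ => ‖F (x + u + z.2, z.1) - F (x + z.2, z.1)‖ₑ) (by fun_prop)
  refine setLIntegral_comp_add_left_le hp hmeas hN (hlip.mono fun _ ht => abs_lipSemi_le ht)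
    (by positivity) ?_ h y
  filter_upwards [hlip] with t ht
  rw [abs_of_nonneg (lipSemi_nonneg _ _), ENNReal.ofReal_mul (by positivity),
    ENNReal.ofReal_mul hh.le, ofReal_lipSemi ht, mul_assoc]
  have h1 := setLIntegral_enorm_le_einf (fun s => F (s + u, t) - F (s, t)) x h
  simp only [add_right_comm x _ u] at h1
  refine h1.trans ?_
  gcongr
  refine (einf_sub_le_lipSemiE (1/p) (fun s => F (s, t)) hu).trans ?_
  have : 0 ≤ 1 / p := by positivity
  gcongr

end Sections


/-- If `1 ≤ p < ∞`, `f ∈ U_p(ℝ²)` and `h > 0`, then the Steklov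
average satisfies `|f_h(x+u, y+v) - f_h(x,y)| ≤ h^{1/p} [φ₁**(h) + φ₂**(h)]`
whenever `0 ≤ u, v ≤ h`. -/
theorem stmt11 (p : ℝ) (hp : 1 ≤ p) (f : ℝ × ℝ → ℝ) (hf : MemUp p f)
    (h : ℝ) (hh : 0 < h) :
    ∀ x y u v : ℝ, 0 ≤ u → u ≤ h → 0 ≤ v → v ≤ h →
      |avg f h (x + u, y + v) - avg f h (x, y)| ≤
        h ^ (1/p) *
          (doubleStar (fun y' => lipSemi (1/p) (fun x' => f (x', y'))) h +
           doubleStar (fun x' => lipSemi (1/p) (fun y' => f (x', y'))) h) := by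
  obtain ⟨hfm, hlip₁, hlip₂, hN₁, hN₂⟩ := hf
  intro x y u v hu huh hv hvh
  set A := ∫ t in Ioc 0 h, rearr (fun y' => lipSemi (1/p) (fun x' => f (x', y'))) t with hA
  set B := ∫ t in Ioc 0 h, rearr (fun x' => lipSemi (1/p) (fun y' => f (x', y'))) t with hB
  have hA0 : 0 ≤ A := integral_nonneg fun _ => rearr_nonneg _ _
  have hB0 : 0 ≤ B := integral_nonneg fun _ => rearr_nonneg _ _
  set μ := (volume.restrict (Ioc (0:ℝ) h)).prod (volume.restrict (Ioc (0:ℝ) h)) with hμ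
  have hfin : ∀ a b : ℝ, Integrable (fun z : ℝ × ℝ => f (a + z.1, b + z.2)) μ := by
    intro a b
    refine ⟨(by fun_prop : Measurable _).aestronglyMeasurable, ?_⟩
    rw [HasFiniteIntegral, hμ, lintegral_prod_symm _ (by fun_prop)]
    exact lintegral_lintegral_enorm_lt_top hp hfm hlip₁ hN₁ hh a b
  have havg : ∀ a b : ℝ, avg f h (a, b) = (∫ z, f (a + z.1, b + z.2) ∂μ) / h ^ 2 := by
    intro a b
    rw [hμ, integral_prod _ (hfin a b)]
    rfl
  have hbound₁ : |∫ z, (f (x + u + z.1, y + v + z.2) - f (x + z.1, y + v + z.2)) ∂μ| ≤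
      h * h ^ (1/p) * A := by
    rw [← Real.norm_eq_abs, ← ENNReal.ofReal_le_ofReal_iff (by positivity), ofReal_norm]
    refine (enorm_integral_le_lintegral_enorm _).trans ?_
    rw [hμ, lintegral_prod_symm _ (by fun_prop)]
    exact lintegral_lintegral_enorm_sub_le hp hfm hlip₁ hN₁ hh x (y + v) hu huh
  have hbound₂ : |∫ z, (f (x + z.1, y + v + z.2) - f (x + z.1, y + z.2)) ∂μ| ≤
      h * h ^ (1/p) * B := by
    rw [← Real.norm_eq_abs, ← ENNReal.ofReal_le_ofReal_iff (by positivity), ofReal_norm]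
    refine (enorm_integral_le_lintegral_enorm _).trans ?_
    rw [hμ, lintegral_prod _ (by fun_prop)]
    exact lintegral_lintegral_enorm_sub_le (F := fun z => f (z.2, z.1)) hp (by fun_prop)
      hlip₂ hN₂ hh y x hv hvh
  rw [integral_sub (hfin _ _) (hfin _ _)] at hbound₁ hbound₂
  rw [havg, havg, ← sub_div, abs_div, abs_of_pos (pow_pos hh 2), div_le_iff₀ (pow_pos hh 2)]
  have hrhs : h ^ (1/p) * (doubleStar (fun y' => lipSemi (1/p) (fun x' => f (x', y'))) h +
      doubleStar (fun x' => lipSemi (1/p) (fun y' => f (x', y'))) h) * h ^ 2 =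
      h * h ^ (1/p) * A + h * h ^ (1/p) * B := by
    simp only [doubleStar, ← hA, ← hB]
    field_simp
  rw [hrhs]
  refine (abs_sub_le _ (∫ z, f (x + z.1, y + v + z.2) ∂μ) _).trans (add_le_add hbound₁ hbound₂)

end
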